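/- Biorthogonality of the rational functions of Hahn type: for all integers n, m with 0 ≤ n ≤ N, 0 ≤ m ≤ N and n ≠ m, Σ_{x=0}^{N} w_x^{(α,β)} · U_n(x;α,β,N) · V_m(x;α,β,N) = 0, where V_m(x;α,β,N) = U_m(N−x; β+2−α, β, N). -/

import Mathlib

/-- Pochhammer symbol `(a)_k = a (a+1) ⋯ (a+k-1)`, with `(a)_0 = 1`. -/
noncomputable def poch (a : ℝ) (k : ℕ) : ℝ := ∏ i ∈ Finset.range k, (a + (i : ℝ))

/-- The rational function of Hahn type `U_n(x;α,β,N)`. -/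
noncomputable def U (α β : ℝ) (N n : ℕ) (x : ℤ) : ℝ :=
  ((-1 : ℝ) ^ n * poch (-(N : ℝ)) n / poch (β + 1) n) *
    ∑ k ∈ Finset.range (n + 1),
      poch (-(x : ℝ)) k * poch (-(n : ℝ)) k * poch (β + (n : ℝ) - (N : ℝ)) k /
        ((Nat.factorial k : ℝ) * poch (-(N : ℝ)) k * poch (α - (x : ℝ)) k)

/-- The biorthogonal partner `V_m(x;α,β,N) = U_m(N-x;β+2-α,β,N)`. -/
noncomputable def V (α β : ℝ) (N m : ℕ) (x : ℤ) : ℝ :=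
  U (β + 2 - α) β N m ((N : ℤ) - x)

/-- The hypergeometric distribution `w_x^{(α,β)}`. -/
noncomputable def w (α β : ℝ) (N x : ℕ) : ℝ :=
  (poch (β - α - (N : ℝ) + 2) N / poch (β - (N : ℝ) + 1) N) *
    (poch (-(N : ℝ)) x * poch (1 - α) x) /
      ((Nat.factorial x : ℝ) * poch (β - α - (N : ℝ) + 2) x)

lemma poch_add (a : ℝ) (k l : ℕ) : poch a (k + l) = poch a k * poch (a + k) l := by
  simp only [poch, Finset.prod_range_add]
  congr 1
  exact Finset.prod_congr rfl fun i _ => by push_cast; ring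

lemma poch_zero (a : ℝ) : poch a 0 = 1 := by simp [poch]

lemma poch_one (a : ℝ) : poch a 1 = a := by simp [poch]

lemma poch_ne_zero {a : ℝ} (ha : ∀ m : ℤ, a ≠ m) (k : ℕ) : poch a k ≠ 0 := by
  refine Finset.prod_ne_zero_iff.2 fun i _ h => ha (-i) ?_
  push_cast
  linarith

lemma poch_reflect (a : ℝ) (k : ℕ) : poch (1 - a - k) k = (-1) ^ k * poch a k := by
  unfold poch
  rw [← Finset.prod_range_reflect, Finset.pow_eq_prod_const, ← Finset.prod_mul_distrib]
  refine Finset.prod_congr rfl fun i hi => ?_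
  rw [Nat.sub_sub, Nat.cast_sub (by have := Finset.mem_range.1 hi; omega)]
  push_cast
  ring

lemma poch_neg_natCast (n k : ℕ) :
    poch (-(n : ℝ)) k = (-1) ^ k * (n.choose k : ℝ) * k.factorial := by
  have h : poch (-(n : ℝ)) k = (-1) ^ k * (n.descFactorial k : ℝ) := by
    induction k with
    | zero => simp [poch_zero]
    | succ k ih =>
      rw [poch_add, ih, poch_one, Nat.descFactorial_succ]
      rcases le_or_gt k n with hk | hk
      · push_cast [Nat.cast_sub hk]
        ring
      · simp [Nat.descFactorial_of_lt hk]
  rw [h, Nat.descFactorial_eq_factorial_mul_choose]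
  push_cast
  ring

lemma poch_neg_natCast_eq_zero {n k : ℕ} (h : n < k) : poch (-(n : ℝ)) k = 0 := by
  simp [poch_neg_natCast, Nat.choose_eq_zero_of_lt h]

/-- The Chu–Vandermonde summation, cleared of denominators. -/
lemma sum_choose_mul_poch (M : ℕ) (a c : ℝ) :
    ∑ y ∈ Finset.range (M + 1), (-1) ^ y * (M.choose y : ℝ) * poch a y * poch (c + y) (M - y) =
      poch (c - a) M := by
  induction M generalizing c with
  | zero => simp [poch_zero]
  | succ M ih =>
    have key : ∀ y ∈ Finset.range (M + 1),
        (-1) ^ y * (M.choose y : ℝ) * poch a y * poch (c + y) (M + 1 - y) +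
          (-1) ^ (y + 1) * (M.choose y : ℝ) * poch a (y + 1) *
            poch (c + (y + 1 : ℕ)) (M + 1 - (y + 1)) =
        (c - a) * ((-1) ^ y * (M.choose y : ℝ) * poch a y * poch (c + 1 + y) (M - y)) := by
      intro y hy
      have hy : y ≤ M := by simpa [Nat.lt_succ_iff] using hy
      have e : M + 1 - y = 1 + (M - y) := by omega
      rw [e, poch_add (c + y), poch_add a y 1, poch_one, poch_one, Nat.add_sub_add_right]
      push_cast
      rw [show c + (y : ℝ) + 1 = c + 1 + y by ring, show c + ((y : ℝ) + 1) = c + 1 + y by ring]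
      ring
    have pascal : ∑ y ∈ Finset.range (M + 1 + 1),
          (-1) ^ y * ((M + 1).choose y : ℝ) * poch a y * poch (c + y) (M + 1 - y) =
        ∑ y ∈ Finset.range (M + 1),
          ((-1) ^ y * (M.choose y : ℝ) * poch a y * poch (c + y) (M + 1 - y) +
          (-1) ^ (y + 1) * (M.choose y : ℝ) * poch a (y + 1) *
            poch (c + (y + 1 : ℕ)) (M + 1 - (y + 1))) := by
      have h0 := Finset.sum_range_succ
        (fun y => (-1) ^ y * (M.choose y : ℝ) * poch a y * poch (c + y) (M + 1 - y)) (M + 1)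
      rw [Finset.sum_range_succ'] at h0
      rw [Finset.sum_range_succ', Finset.sum_add_distrib]
      simp only [Nat.choose_succ_succ, Nat.choose_succ_self, Nat.choose_zero_right, Nat.cast_add,
        mul_add, add_mul, Finset.sum_add_distrib, Nat.cast_zero, mul_zero, zero_mul] at h0 ⊢
      linarith
    rw [pascal, Finset.sum_congr rfl key, ← Finset.mul_sum, ih, add_comm M 1, poch_add, poch_one]
    push_cast
    rw [show c + 1 - a = c - a + 1 by ring]

lemma exists_polynomial_eval_eq_poch (a : ℝ) (k : ℕ) :
    ∃ P : Polynomial ℝ, P.natDegree ≤ k ∧ ∀ t, P.eval t = poch (a + t) k := by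
  refine ⟨(ascPochhammer ℝ k).comp (Polynomial.C a + Polynomial.X), ?_, fun t => ?_⟩
  · refine Polynomial.natDegree_comp_le.trans ?_
    rw [ascPochhammer_natDegree, add_comm, Polynomial.natDegree_X_add_C, mul_one]
  · rw [Polynomial.eval_comp]
    simp only [Polynomial.eval_add, Polynomial.eval_C, Polynomial.eval_X]
    induction k with
    | zero => simp [poch_zero]
    | succ k ih => rw [ascPochhammer_succ_eval, ih, poch_add, poch_one]

/-- A terminating balanced `₃F₂` sum which vanishes. -/
lemma sum_poch_eq_zero {N n j : ℕ} {b : ℝ} (hb : ∀ m : ℤ, b ≠ m) (hn : n ≤ N) (hj : j < n) :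
    ∑ k ∈ Finset.range (n + 1), poch (-(n : ℝ)) k * poch (b + n) k /
      (k.factorial * poch (-(N : ℝ)) k) *
        (poch (-(N : ℝ)) (k + j) / poch (b + 1) (k + j)) = 0 := by
  have hb1 : ∀ m : ℤ, b + 1 ≠ m := fun m h => hb (m - 1) (by push_cast; linarith)
  obtain ⟨P, hPd, hP⟩ := exists_polynomial_eval_eq_poch (-(N : ℝ)) j
  obtain ⟨Q, hQd, hQ⟩ := exists_polynomial_eval_eq_poch (b + 1 + j) (n - 1 - j)
  have hd : (P * Q).natDegree < n := by
    have := Polynomial.natDegree_mul_le (p := P) (q := Q)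
    omega
  have h := congrFun (Polynomial.fwdDiff_iter_eq_zero_of_degree_lt hd) 0
  rw [fwdDiff_iter_eq_sum_shift] at h
  have h2 : ∀ k ∈ Finset.range (n + 1), poch (-(n : ℝ)) k * poch (b + n) k /
      (k.factorial * poch (-(N : ℝ)) k) *
        (poch (-(N : ℝ)) (k + j) / poch (b + 1) (k + j)) =
      (-1) ^ n / poch (b + 1) (n - 1) *
        (((-1 : ℤ) ^ (n - k) * n.choose k) • (P * Q).eval ((0 : ℝ) + k • (1 : ℝ))) := by
    intro k hk
    have hk : k ≤ n := by simpa [Nat.lt_succ_iff] using hk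
    have e : poch (b + 1) (n - 1) * poch (b + n) k =
        poch (b + 1) (k + j) * poch (b + 1 + j + k) (n - 1 - j) := by
      have e1 := poch_add (b + 1) (n - 1) k
      have e2 := poch_add (b + 1) (k + j) (n - 1 - j)
      rw [show n - 1 + k = k + j + (n - 1 - j) by omega, e2,
        Nat.cast_sub (by omega : 1 ≤ n)] at e1
      push_cast at e1
      rw [show b + 1 + ((n : ℝ) - 1) = b + n by ring,
        show b + 1 + ((k : ℝ) + j) = b + 1 + j + k by ring] at e1
      exact e1.symm
    have z1 := poch_ne_zero hb1 (n - 1)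
    have z2 := poch_ne_zero hb1 (k + j)
    have z3 : poch (-(N : ℝ)) k ≠ 0 := by
      rw [poch_neg_natCast]
      have := (Nat.choose_pos (hk.trans hn)).ne'
      positivity
    have z4 : (k.factorial : ℝ) ≠ 0 := by positivity
    have s : (-1 : ℝ) ^ k = (-1) ^ n * (-1) ^ (n - k) := by
      rw [← pow_add, show n + (n - k) = k + 2 * (n - k) by omega, pow_add, pow_mul]
      simp
    rw [Polynomial.eval_mul, nsmul_one, zero_add, hP, hQ, zsmul_eq_mul, poch_add (-(N : ℝ)) k j,
      poch_neg_natCast n k, s]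
    push_cast
    field_simp
    linear_combination (n.choose k : ℝ) * poch (-(N : ℝ) + k) j * e
  rw [Finset.sum_congr rfl h2, ← Finset.mul_sum, h]
  simp

lemma sum_w_mul_eq {N : ℕ} {α β : ℝ} (hα : ∀ m : ℤ, α ≠ m) (hβ : ∀ m : ℤ, β ≠ m)
    (hβα : ∀ m : ℤ, β - α ≠ m) (k j : ℕ) :
    ∑ x ∈ Finset.range (N + 1), w α β N x * (poch (-(x : ℝ)) k / poch (α - x) k) *
      (poch (-((N : ℝ) - x)) j / poch (β + 2 - α - (N - x)) j) =
    poch (-(N : ℝ)) (k + j) / poch (β - N + 1) (k + j) := by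
  have vj : ∀ x ∈ Finset.range (N + 1), N < x + j → poch (-((N : ℝ) - x)) j = 0 := by
    intro x hx h
    have hx : x ≤ N := by simpa [Nat.lt_succ_iff] using hx
    rw [← Nat.cast_sub hx]
    exact poch_neg_natCast_eq_zero (by omega)
  rcases lt_or_ge N (k + j) with h | h
  · rw [poch_neg_natCast_eq_zero h, zero_div]
    refine Finset.sum_eq_zero fun x hx => ?_
    rcases lt_or_ge x k with hk | hk
    · simp [poch_neg_natCast_eq_zero hk]
    · rw [vj x hx (by omega), zero_div, mul_zero]
  obtain ⟨M, rfl⟩ := Nat.exists_eq_add_of_le h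
  have hc : ∀ m : ℤ, β - α - ((k + j + M : ℕ) : ℝ) + 2 ≠ m := fun m h =>
    hβα (m + (k + j + M : ℕ) - 2) (by push_cast at h ⊢; linarith)
  have hb : ∀ m : ℤ, β - ((k + j + M : ℕ) : ℝ) + 1 ≠ m := fun m h =>
    hβ (m + (k + j + M : ℕ) - 1) (by push_cast at h ⊢; linarith)
  have ha : ∀ m : ℤ, 1 - α ≠ m := fun m h => hα (1 - m) (by push_cast; linarith)
  unfold w
  generalize hcd : β - α - ((k + j + M : ℕ) : ℝ) + 2 = c at hc
  generalize hbd : β - ((k + j + M : ℕ) : ℝ) + 1 = b at hb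
  have term : ∀ y ∈ Finset.range (M + 1),
      poch c (k + j + M) / poch b (k + j + M) *
        (poch (-((k + j + M : ℕ) : ℝ)) (k + y) * poch (1 - α) (k + y)) /
        (((k + y).factorial : ℝ) * poch c (k + y)) *
        (poch (-((k + y : ℕ) : ℝ)) k / poch (α - (k + y : ℕ)) k) *
        (poch (-(((k + j + M : ℕ) : ℝ) - (k + y : ℕ))) j /
          poch (β + 2 - α - ((k + j + M : ℕ) - (k + y : ℕ))) j) =
      poch (-((k + j + M : ℕ) : ℝ)) (k + j) / poch b (k + j + M) *
        ((-1) ^ y * (M.choose y : ℝ) * poch (1 - α) y * poch (c + (k + j) + y) (M - y)) := by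
    intro y hy
    have hy : y ≤ M := by simpa [Nat.lt_succ_iff] using hy
    have e1 : poch (-((k + j + M : ℕ) : ℝ)) (k + y) *
        poch (-(((k + j + M : ℕ) : ℝ) - (k + y : ℕ))) j =
        poch (-((k + j + M : ℕ) : ℝ)) (k + j) * ((-1) ^ y * (M.choose y : ℝ) * y.factorial) := by
      rw [← poch_neg_natCast, neg_sub, sub_eq_neg_add, ← poch_add, add_right_comm k y j,
        poch_add _ (k + j) y]
      congr 2
      push_cast
      ring
    have e2 : poch (1 - α) (k + y) = (-1) ^ k * poch (1 - α) y * poch (α - (k + y : ℕ)) k := by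
      have := poch_reflect (1 - α + y) k
      rw [show 1 - (1 - α + y) - k = α - ((k + y : ℕ) : ℝ) by push_cast; ring] at this
      rw [add_comm k y, poch_add, add_comm y k, this]
      have s : (-1 : ℝ) ^ k * (-1) ^ k = 1 := by rw [← mul_pow]; simp
      linear_combination -(poch (1 - α) y * poch (1 - α + y) k) * s
    have e3 : poch (-((k + y : ℕ) : ℝ)) k * y.factorial = (-1) ^ k * (k + y).factorial := by
      rw [poch_neg_natCast, ← Nat.choose_mul_factorial_mul_factorial (Nat.le_add_right k y),
        Nat.add_sub_cancel_left]
      push_cast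
      ring
    have e4 : poch c (k + j + M) = poch c (k + y) *
        poch (β + 2 - α - ((k + j + M : ℕ) - (k + y : ℕ))) j *
        poch (c + (k + j) + y) (M - y) := by
      rw [show k + j + M = k + y + j + (M - y) by omega, poch_add, poch_add,
        show k + y + j + (M - y) = k + j + M by omega]
      congr 2
      · congr 1
        linarith
      · push_cast
        ring
    have z1 : poch c (k + y) ≠ 0 := poch_ne_zero hc _
    have z2 : poch b (k + j + M) ≠ 0 := poch_ne_zero hb _
    have z3 : poch (α - (k + y : ℕ)) k ≠ 0 := poch_ne_zero
      (fun m h => hα (m + (k + y : ℕ)) (by push_cast at h ⊢; linarith)) _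
    have z4 : poch (β + 2 - α - ((k + j + M : ℕ) - (k + y : ℕ))) j ≠ 0 := poch_ne_zero
      (fun m h => hβα (m - 2 + ((k + j + M : ℕ) - (k + y : ℕ))) (by push_cast at h ⊢; linarith)) _
    have z5 : ((k + y).factorial : ℝ) ≠ 0 := by positivity
    have s : (-1 : ℝ) ^ k * (-1) ^ k = 1 := by rw [← mul_pow]; simp
    rw [e4, e2]
    generalize poch (α - (k + y : ℕ)) k = p1 at *
    generalize poch (β + 2 - α - ((k + j + M : ℕ) - (k + y : ℕ))) j = p2 at *
    generalize poch (-((k + j + M : ℕ) : ℝ)) (k + y) = p3 at *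
    generalize poch (-(((k + j + M : ℕ) : ℝ) - (k + y : ℕ))) j = p4 at *
    generalize poch (-((k + j + M : ℕ) : ℝ)) (k + j) = p5 at *
    generalize poch (-((k + y : ℕ) : ℝ)) k = p6 at *
    generalize poch (1 - α) y = p7 at *
    generalize poch (c + (k + j) + y) (M - y) = p8 at *
    generalize (k + y).factorial = f at *
    field_simp
    linear_combination p7 * p8 * ((-1) ^ k * p6 * e1 +
      p5 * (-1) ^ y * M.choose y * (-1) ^ k * e3 + p5 * (-1) ^ y * M.choose y * f * s)
  rw [show k + j + M + 1 = k + ((M + 1) + j) by ring, Finset.sum_range_add, Finset.sum_range_add,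
    Finset.sum_eq_zero (s := Finset.range k), Finset.sum_eq_zero (s := Finset.range j), add_zero,
    zero_add, Finset.sum_congr rfl term, ← Finset.mul_sum, sum_choose_mul_poch, poch_add b]
  · rw [show c + (k + j) - (1 - α) = b + ((k + j : ℕ) : ℝ) by push_cast at *; linarith]
    have : poch (b + ((k + j : ℕ) : ℝ)) M ≠ 0 := poch_ne_zero
      (fun m h => hb (m - (k + j : ℕ)) (by push_cast at h ⊢; linarith)) _
    have := poch_ne_zero hb (k + j)
    field_simp
  · intro i hi
    have hi := Finset.mem_range.1 hi
    rw [vj _ (Finset.mem_range.2 (by omega)) (by omega)]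
    simp
  · intro x hx
    rw [poch_neg_natCast_eq_zero (Finset.mem_range.1 hx)]
    simp

theorem statement10 (N : ℕ) (hN : 0 < N) (α β : ℝ)
    (hα : ∀ m : ℤ, α ≠ (m : ℝ)) (hβ : ∀ m : ℤ, β ≠ (m : ℝ))
    (hβα : ∀ m : ℤ, β - α ≠ (m : ℝ))
    (n m : ℕ) (hn : n ≤ N) (hm : m ≤ N) (hnm : n ≠ m) :
    ∑ x ∈ Finset.range (N + 1), w α β N x * U α β N n (x : ℤ) * V α β N m (x : ℤ) = 0 := by
  have hb : ∀ m : ℤ, β - N ≠ m := fun m h => hβ (m + N) (by push_cast; linarith)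
  let a : ℕ → ℕ → ℝ := fun n k =>
    poch (-(n : ℝ)) k * poch (β - N + n) k / (k.factorial * poch (-(N : ℝ)) k)
  let R : ℕ → ℝ := fun k => poch (-(N : ℝ)) k / poch (β - N + 1) k
  have vanish : ∀ p q : ℕ, p ≤ N → q < p →
      ∑ j ∈ Finset.range (q + 1), a q j * ∑ k ∈ Finset.range (p + 1), a p k * R (k + j) = 0 :=
    fun p q hp hq => Finset.sum_eq_zero fun j hj => by
      rw [sum_poch_eq_zero hb hp ((Nat.lt_succ_iff.1 (Finset.mem_range.1 hj)).trans_lt hq),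
        mul_zero]
  have main : ∑ k ∈ Finset.range (n + 1), ∑ j ∈ Finset.range (m + 1),
      a n k * a m j * R (k + j) = 0 := by
    rcases lt_or_gt_of_ne hnm with h | h
    · rw [← vanish m n hm h]
      simp only [Finset.mul_sum, mul_assoc, add_comm]
    · rw [Finset.sum_comm, ← vanish n m hn h]
      simp only [Finset.mul_sum, mul_left_comm, mul_assoc]
  have expand : ∀ x : ℕ, w α β N x * U α β N n (x : ℤ) * V α β N m (x : ℤ) =
      ((-1 : ℝ) ^ n * poch (-(N : ℝ)) n / poch (β + 1) n) *
      ((-1 : ℝ) ^ m * poch (-(N : ℝ)) m / poch (β + 1) m) *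
      ∑ k ∈ Finset.range (n + 1), ∑ j ∈ Finset.range (m + 1), a n k * a m j *
        (w α β N x * (poch (-(x : ℝ)) k / poch (α - x) k) *
          (poch (-((N : ℝ) - x)) j / poch (β + 2 - α - (N - x)) j)) := by
    intro x
    unfold V U
    push_cast
    rw [show ∀ W A S B T : ℝ, W * (A * S) * (B * T) = A * B * (W * (S * T)) by intros; ring,
      Finset.sum_mul_sum]
    simp only [Finset.mul_sum, a]
    refine Finset.sum_congr rfl fun k _ => Finset.sum_congr rfl fun j _ => ?_
    rw [add_sub_right_comm, add_sub_right_comm]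
    ring
  rw [Finset.sum_congr rfl fun x _ => expand x, ← Finset.mul_sum, Finset.sum_comm,
    Finset.sum_congr rfl fun k _ => Finset.sum_comm]
  simp only [← Finset.mul_sum, sum_w_mul_eq hα hβ hβα]
  rw [main, mul_zero]
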